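/- Each of the binary codes ρ_C(E_10) and ρ_C(B_10) is a singly-even self-dual [40,20,8] code: it has 𝔽₂-dimension 20, equals its dual under the standard inner product on 𝔽₂^40, every codeword has even weight, some codeword has weight ≡ 2 (mod 4), and its minimum nonzero Hamming weight is 8. -/

import Mathlib

open scoped BigOperators

section Defs

variable {F : Type} [Field F] [DecidableEq F]

/-- The binary coordinate in column `j` (0-indexed), row `k`. -/
def idx (j : Fin 10) (k : Fin 4) : Fin 40 :=
  ⟨4 * j.val + k.val, by have := j.isLt; have := k.isLt; omega⟩

/-- The map φ : GF(4) → 𝔽₂⁴, 0↦0000, 1↦0011, ω↦0101, ϖ↦0110. -/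
def phi (ω : F) : F → (Fin 4 → ZMod 2) := fun x =>
  if x = 0 then ![0, 0, 0, 0]
  else if x = 1 then ![0, 0, 1, 1]
  else if x = ω then ![0, 1, 0, 1]
  else ![0, 1, 1, 0]

/-- Ĉ : the image of a quaternary code under coordinatewise φ. -/
def hatSet (ω : F) (C : Set (Fin 10 → F)) : Set (Fin 40 → ZMod 2) :=
  { v | ∃ c ∈ C, ∀ (j : Fin 10) (k : Fin 4), v (idx j k) = phi ω (c j) k }

/-- d₄¹⁰ : binary vectors of length 40 constant on each of the ten columns. -/
def d4ten : Set (Fin 40 → ZMod 2) :=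
  { v | ∀ (j : Fin 10) (k k' : Fin 4), v (idx j k) = v (idx j k') }

/-- (d₄¹⁰)₀ : the subcode of d₄¹⁰ of codewords of weight divisible by 8. -/
def d4ten0 : Set (Fin 40 → ZMod 2) :=
  { v | v ∈ d4ten ∧ 8 ∣ hammingNorm v }

/-- The generator 1000 1000 ... 1000 of e_C. -/
def eCvec : Fin 40 → ZMod 2 := fun i => if i.val % 4 = 0 then 1 else 0

/-- The generator 1000 (×9) 0111 of e_B. -/
def eBvec : Fin 40 → ZMod 2 := fun i =>
  if i.val < 36 then (if i.val % 4 = 0 then 1 else 0)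
  else (if i.val % 4 = 0 then 0 else 1)

/-- ρ_C(C) = Ĉ + (d₄¹⁰)₀ + e_C. -/
def rhoC (ω : F) (C : Set (Fin 10 → F)) : Set (Fin 40 → ZMod 2) :=
  { v | ∃ a ∈ hatSet ω C, ∃ b ∈ d4ten0,
      ∃ e ∈ ({0, eCvec} : Set (Fin 40 → ZMod 2)), v = a + b + e }

/-- ρ_B(C) = Ĉ + (d₄¹⁰)₀ + e_B. -/
def rhoB (ω : F) (C : Set (Fin 10 → F)) : Set (Fin 40 → ZMod 2) :=
  { v | ∃ a ∈ hatSet ω C, ∃ b ∈ d4ten0,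
      ∃ e ∈ ({0, eBvec} : Set (Fin 40 → ZMod 2)), v = a + b + e }

/-- The trace inner product x⋆y = Σ Tr(xᵢ ȳᵢ), computed in GF(4) (its value lies
in the prime subfield GF(2)). -/
def traceIP (x y : Fin 10 → F) : F :=
  ∑ i, ((x i * (y i) ^ 2) + (x i * (y i) ^ 2) ^ 2)

/-- The dual of an additive code with respect to the trace inner product. -/
def addDual (C : Set (Fin 10 → F)) : Set (Fin 10 → F) :=
  { x | ∀ c ∈ C, traceIP x c = 0 }

/-- The dual of a binary code of length 40 under the standard inner product. -/
def binDual (S : Set (Fin 40 → ZMod 2)) : Set (Fin 40 → ZMod 2) :=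
  { x | ∀ c ∈ S, ∑ i, x i * c i = 0 }

/-- The dual of a quaternary code under the Hermitian inner product ⟨x,y⟩ = Σ xᵢ ȳᵢ. -/
def hermDual (S : Set (Fin 10 → F)) : Set (Fin 10 → F) :=
  { x | ∀ c ∈ S, ∑ i, x i * (c i) ^ 2 = 0 }

/-- The Hermitian self-dual [10,5,4] code E₁₀ over GF(4). -/
def E10 (ω : F) : Submodule F (Fin 10 → F) :=
  Submodule.span F {![1,1,1,1,0,0,0,0,0,0], ![0,0,1,1,1,1,0,0,0,0],
    ![0,0,0,0,1,1,1,1,0,0], ![0,0,0,0,0,0,1,1,1,1],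
    ![1,0,1,0,1,0,1,0,ω,ω^2]}

/-- The Hermitian self-dual [10,5,4] code B₁₀ over GF(4). -/
def B10 (ω : F) : Submodule F (Fin 10 → F) :=
  Submodule.span F {![1,1,1,1,0,0,0,0,0,0], ![0,1,ω,ω^2,1,0,0,0,0,0],
    ![0,0,0,0,0,1,1,1,1,0], ![0,0,0,0,0,0,1,ω,ω^2,1],
    ![0,1,ω^2,ω,0,0,1,ω^2,ω,0]}

/-- Interpret a bit as an element of GF(4). -/
def b2f (x : ZMod 2) : F := if x = 1 then 1 else 0

/-- The projection 𝔽₂⁴⁰ → GF(4)¹⁰ : column j ↦ v₂ᵢₙ·1 + v·ω + v·ϖ with row labels 0,1,ω,ϖ. -/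
def Proj (ω : F) (v : Fin 40 → ZMod 2) : Fin 10 → F := fun j =>
  b2f (v (idx j 1)) * 1 + b2f (v (idx j 2)) * ω + b2f (v (idx j 3)) * ω ^ 2

/-- The parity of column j (1 = odd number of ones). -/
def colPar (v : Fin 40 → ZMod 2) (j : Fin 10) : ZMod 2 := ∑ k, v (idx j k)

/-- The parity of the top row (1 = odd number of ones). -/
def topPar (v : Fin 40 → ZMod 2) : ZMod 2 := ∑ j, v (idx j 0)

/-- The coordinate permutation of Fin 10 permuting the five blocks {2m, 2m+1}
as units according to π, preserving order within blocks. -/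
def blockPerm (π : Equiv.Perm (Fin 5)) : Fin 10 → Fin 10 := fun t =>
  ⟨2 * (π ⟨t.val / 2, by have := t.isLt; omega⟩).val + t.val % 2, by
    have := (π ⟨t.val / 2, by have := t.isLt; omega⟩).isLt; have := t.isLt; omega⟩

/-- The coordinate permutation of Fin 10 interchanging the two coordinates within
each block belonging to S, fixing all other coordinates. -/
def blockSwap (S : Finset (Fin 5)) : Fin 10 → Fin 10 := fun t =>
  if (⟨t.val / 2, by have := t.isLt; omega⟩ : Fin 5) ∈ S then
    ⟨2 * (t.val / 2) + (1 - t.val % 2), by have := t.isLt; omega⟩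
  else t

end Defs

section GF4

variable {F : Type} [Field F] {ω : F}

theorem charP_two_of_card_eq_four [Fintype F] (hF : Fintype.card F = 4) : CharP F 2 := by
  have h : ((4 : ℕ) : F) = 0 := hF ▸ Nat.cast_card_eq_zero F
  have h2 : (2 : F) = 0 := by
    have : (2 : F) * 2 = 0 := by push_cast at h; linear_combination h
    simpa using this
  exact CharTwo.of_one_ne_zero_of_two_eq_zero one_ne_zero h2

theorem gf4_cases [Fintype F] (hF : Fintype.card F = 4) (hω : ω ^ 2 = ω + 1) (x : F) :
    x = 0 ∨ x = 1 ∨ x = ω ∨ x = ω + 1 := by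
  have := charP_two_of_card_eq_four hF
  have h2 : (2 : F) = 0 := CharTwo.two_eq_zero
  have h4 : x ^ 4 = x := hF ▸ FiniteField.pow_card x
  have h : x * ((x - 1) * ((x - ω) * (x - (ω + 1)))) = 0 := by grind
  simpa [sub_eq_zero] using h

theorem omega_ne_zero (hω : ω ^ 2 = ω + 1) : ω ≠ 0 := by
  rintro rfl
  simp at hω

theorem omega_ne_one [CharP F 2] (hω : ω ^ 2 = ω + 1) : ω ≠ 1 := by
  rintro rfl
  simp [CharTwo.add_self_eq_zero] at hω

theorem omega_add_one_ne_zero [CharP F 2] (hω : ω ^ 2 = ω + 1) : ω + 1 ≠ 0 := by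
  rw [← hω]
  exact pow_ne_zero 2 (omega_ne_zero hω)

variable [DecidableEq F]

@[simp] theorem phi_zero (ω : F) : phi ω 0 = 0 := by
  ext k
  fin_cases k <;> simp [phi]

theorem phi_one (ω : F) : phi ω 1 = ![0, 0, 1, 1] := by simp [phi]

theorem phi_omega [CharP F 2] (hω : ω ^ 2 = ω + 1) : phi ω ω = ![0, 1, 0, 1] := by
  simp [phi, omega_ne_zero hω, omega_ne_one hω]

theorem phi_omega_add_one [CharP F 2] (hω : ω ^ 2 = ω + 1) :
    phi ω (ω + 1) = ![0, 1, 1, 0] := by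
  simp [phi, omega_ne_zero hω, omega_add_one_ne_zero hω]

theorem phi_add [Fintype F] (hF : Fintype.card F = 4) (hω : ω ^ 2 = ω + 1) (x y : F) :
    phi ω (x + y) = phi ω x + phi ω y := by
  have := charP_two_of_card_eq_four hF
  have h2 (x : F) : x + x = 0 := CharTwo.add_self_eq_zero x
  have e1 : 1 + (ω + 1) = ω := by linear_combination h2 1
  have e2 : ω + (ω + 1) = 1 := by linear_combination h2 ω
  have e3 : ω + 1 + ω = 1 := by linear_combination h2 ω
  have e4 : ω + 1 + 1 = ω := by linear_combination h2 1
  rcases gf4_cases hF hω x with hx | hx | hx | hx <;>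
  rcases gf4_cases hF hω y with hy | hy | hy | hy <;>
  simp only [hx, hy, zero_add, add_zero, phi_zero, h2, e1, e2, e3, e4, add_comm 1 ω, phi_one, phi_omega hω,
    phi_omega_add_one hω] <;> decide

theorem phi_apply_zero (ω x : F) : phi ω x 0 = 0 := by
  unfold phi
  split_ifs <;> rfl

theorem sum_phi (ω x : F) : ∑ k, phi ω x k = 0 := by
  unfold phi
  split_ifs <;> rfl

/-- The inner product of columns is the trace form of `GF(4)`. -/
theorem cast_phi_inner [Fintype F] [CharP F 2] (hF : Fintype.card F = 4) (hω : ω ^ 2 = ω + 1)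
    (x y : F) :
    ZMod.castHom (dvd_refl 2) F (∑ k, phi ω x k * phi ω y k) =
      x * y ^ 2 + (x * y ^ 2) ^ 2 := by
  have h2 : (2 : F) = 0 := CharTwo.two_eq_zero
  rcases gf4_cases hF hω x with hx | hx | hx | hx <;>
  rcases gf4_cases hF hω y with hy | hy | hy | hy <;>
  simp only [hx, hy, phi_zero, phi_one, phi_omega hω, phi_omega_add_one hω, Fin.sum_univ_four,
    Matrix.cons_val, Pi.zero_apply, mul_zero, zero_mul, mul_one, add_zero, zero_add, map_zero,
    map_one, map_add] <;> grind

theorem two_le_hammingNorm_column (ω : F) {x : F} (hx : x ≠ 0) (a : ZMod 2) :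
    2 ≤ hammingNorm (fun k => phi ω x k + a) := by
  unfold phi
  rw [if_neg hx]
  split_ifs <;> revert a <;> decide

/-- A column is determined by its parity, its top entry and its projection to `GF(4)`. -/
theorem column_eq [Fintype F] (hF : Fintype.card F = 4) (hω : ω ^ 2 = ω + 1)
    (a : Fin 4 → ZMod 2) (k : Fin 4) :
    a k = phi ω (b2f (a 1) * 1 + b2f (a 2) * ω + b2f (a 3) * ω ^ 2) k + (a 0 + ∑ l, a l)
      + if k = 0 then ∑ l, a l else 0 := by
  have := charP_two_of_card_eq_four hF
  have h2 (x : F) : x + x = 0 := CharTwo.add_self_eq_zero x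
  have e1 : 1 + (ω + 1) = ω := by linear_combination h2 1
  have e2 : ω + (ω + 1) = 1 := by linear_combination h2 ω
  have e3 : ω + 1 + (ω + 1) = 0 := h2 _
  have bit (x : ZMod 2) : x = 0 ∨ x = 1 := by revert x; decide
  rw [Fin.sum_univ_four, hω]
  generalize a0 : a 0 = x0
  rcases bit (a 1) with a1 | a1 <;> rcases bit (a 2) with a2 | a2 <;>
  rcases bit (a 3) with a3 | a3 <;>
  simp only [a1, a2, a3, b2f, zero_ne_one, if_true, if_false, zero_mul, one_mul, zero_add,
    add_zero, e1, e2, e3, add_comm 1 ω, phi_zero, phi_one, phi_omega hω, phi_omega_add_one hω] <;>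
  fin_cases k <;> simp [a0, a1, a2, a3] <;> clear a0 <;> revert x0 <;> decide

end GF4

section Words

/-- The bijection between (column, row) pairs and binary coordinates. -/
def coordEquiv : Fin 10 × Fin 4 ≃ Fin 40 := finProdFinEquiv

theorem coordEquiv_apply (j : Fin 10) (k : Fin 4) : coordEquiv (j, k) = idx j k := by
  apply Fin.ext
  simp [coordEquiv, idx, finProdFinEquiv]
  omega

theorem sum_eq_sum_idx {M : Type*} [AddCommMonoid M] (f : Fin 40 → M) :
    ∑ i, f i = ∑ j, ∑ k, f (idx j k) := by
  rw [← coordEquiv.sum_comp, Fintype.sum_prod_type]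
  simp only [coordEquiv_apply]

theorem ext_idx {v w : Fin 40 → ZMod 2} (h : ∀ j k, v (idx j k) = w (idx j k)) : v = w := by
  ext i
  obtain ⟨⟨j, k⟩, rfl⟩ := coordEquiv.surjective i
  rw [coordEquiv_apply, h]

theorem hammingNorm_eq_sum {ι : Type*} [Fintype ι] {M : Type*} [DecidableEq M] [Zero M]
    (v : ι → M) : hammingNorm v = ∑ i, if v i ≠ 0 then 1 else 0 := by
  simp [hammingNorm, Finset.card_filter]

theorem hammingNorm_eq_sum_columns (v : Fin 40 → ZMod 2) :
    hammingNorm v = ∑ j, hammingNorm fun k => v (idx j k) := by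
  simp only [hammingNorm_eq_sum, sum_eq_sum_idx]

theorem cast_hammingNorm {ι : Type*} [Fintype ι] (v : ι → ZMod 2) :
    (hammingNorm v : ZMod 2) = ∑ i, v i := by
  rw [hammingNorm_eq_sum, Nat.cast_sum]
  refine Finset.sum_congr rfl fun i _ => ?_
  generalize v i = x
  revert x
  decide

theorem even_hammingNorm_iff {ι : Type*} [Fintype ι] (v : ι → ZMod 2) :
    Even (hammingNorm v) ↔ ∑ i, v i = 0 := by
  rw [← cast_hammingNorm, ZMod.natCast_eq_zero_iff_even]

theorem idx_val_mod (j : Fin 10) (k : Fin 4) : (idx j k).val % 4 = k.val := by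
  simp only [idx]
  omega

theorem eCvec_idx (j : Fin 10) (k : Fin 4) : eCvec (idx j k) = if k = 0 then 1 else 0 := by
  simp only [eCvec, idx_val_mod, Fin.ext_iff, Fin.val_zero]

variable {F : Type} [Field F] [DecidableEq F] {ω : F}

/-- The binary word with columns `φ (c j) + u j • 1111 + t • 1000`. -/
def word (ω : F) (c : Fin 10 → F) (u : Fin 10 → ZMod 2) (t : ZMod 2) : Fin 40 → ZMod 2 := fun i =>
  phi ω (c (coordEquiv.symm i).1) (coordEquiv.symm i).2 + u (coordEquiv.symm i).1 +
    if (coordEquiv.symm i).2 = 0 then t else 0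

@[simp] theorem word_idx (ω : F) (c : Fin 10 → F) (u : Fin 10 → ZMod 2) (t : ZMod 2)
    (j : Fin 10) (k : Fin 4) :
    word ω c u t (idx j k) = phi ω (c j) k + u j + if k = 0 then t else 0 := by
  simp [word, ← coordEquiv_apply]

theorem hammingNorm_const_column (a : ZMod 2) :
    hammingNorm (fun _ : Fin 4 => a) = 4 * if a ≠ 0 then 1 else 0 := by
  revert a
  decide

theorem hammingNorm_word_zero_zero (ω : F) (u : Fin 10 → ZMod 2) :
    hammingNorm (word ω 0 u 0) = 4 * hammingNorm u := by
  rw [hammingNorm_eq_sum_columns, hammingNorm_eq_sum u, Finset.mul_sum]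
  simp [-mul_ite, hammingNorm_const_column]

theorem mem_d4ten0_iff (ω : F) (v : Fin 40 → ZMod 2) :
    v ∈ d4ten0 ↔ ∃ u : Fin 10 → ZMod 2, ∑ j, u j = 0 ∧ v = word ω 0 u 0 := by
  have h8 (u : Fin 10 → ZMod 2) : 8 ∣ hammingNorm (word ω 0 u 0) ↔ ∑ j, u j = 0 := by
    rw [hammingNorm_word_zero_zero, ← even_hammingNorm_iff, even_iff_two_dvd]
    omega
  constructor
  · rintro ⟨h, hw⟩
    have hv : v = word ω 0 (fun j => v (idx j 0)) 0 := ext_idx fun j k => by simp [h j k 0]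
    exact ⟨_, (h8 _).1 (hv ▸ hw), hv⟩
  · rintro ⟨u, hu, rfl⟩
    exact ⟨fun j k k' => by simp, (h8 u).2 hu⟩

theorem mem_rhoC_iff (ω : F) (C : Set (Fin 10 → F)) (v : Fin 40 → ZMod 2) :
    v ∈ rhoC ω C ↔ ∃ c ∈ C, ∃ u : Fin 10 → ZMod 2, ∃ t, ∑ j, u j = 0 ∧ v = word ω c u t := by
  constructor
  · rintro ⟨a, ⟨c, hc, ha⟩, b, hb, e, he, rfl⟩
    obtain ⟨u, hu, rfl⟩ := (mem_d4ten0_iff ω b).1 hb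
    rcases he with rfl | rfl
    · exact ⟨c, hc, u, 0, hu, ext_idx fun j k => by simp [ha]⟩
    · exact ⟨c, hc, u, 1, hu, ext_idx fun j k => by simp [ha, eCvec_idx]⟩
  · rintro ⟨c, hc, u, t, hu, rfl⟩
    have ht : t = 0 ∨ t = 1 := by revert t; decide
    refine ⟨word ω c 0 0, ⟨c, hc, fun j k => by simp⟩, word ω 0 u 0,
      (mem_d4ten0_iff ω _).2 ⟨u, hu, rfl⟩, if t = 0 then 0 else eCvec, ?_, ext_idx fun j k => ?_⟩
    · split_ifs <;> simp
    · rcases ht with rfl | rfl <;> simp [eCvec_idx]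

theorem word_add [Fintype F] (hF : Fintype.card F = 4) (hω : ω ^ 2 = ω + 1)
    (c c' : Fin 10 → F) (u u' : Fin 10 → ZMod 2) (t t' : ZMod 2) :
    word ω c u t + word ω c' u' t' = word ω (c + c') (u + u') (t + t') := by
  refine ext_idx fun j k => ?_
  simp only [Pi.add_apply, word_idx, phi_add hF hω]
  split_ifs <;> ring

theorem sum_word_mul_word (ω : F) (c c' : Fin 10 → F) (u u' : Fin 10 → ZMod 2) (t t' : ZMod 2) :
    ∑ i, word ω c u t i * word ω c' u' t' i =
      (∑ j, ∑ k, phi ω (c j) k * phi ω (c' j) k) + t' * ∑ j, u j + t * ∑ j, u' j := by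
  have column (j : Fin 10) : ∑ k, word ω c u t (idx j k) * word ω c' u' t' (idx j k) =
      (∑ k, phi ω (c j) k * phi ω (c' j) k) + t' * u j + t * u' j + t * t' := by
    have h := sum_phi ω (c j)
    have h' := sum_phi ω (c' j)
    have h2 : (2 : ZMod 2) = 0 := rfl
    have p0 := phi_apply_zero ω (c j)
    have p0' := phi_apply_zero ω (c' j)
    simp only [Fin.sum_univ_four, word_idx] at h h' ⊢
    simp only [Fin.isValue, p0, p0', if_true, one_ne_zero, if_false, Fin.reduceEq] at h h' ⊢
    linear_combination u j * h' + u' j * h + 2 * u j * u' j * h2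
  simp only [sum_eq_sum_idx, column, Finset.sum_add_distrib, ← Finset.mul_sum]
  have h10 : (10 : ZMod 2) = 0 := rfl
  simp [h10]

theorem sum_phi_eq_zero_iff [Fintype F] (hF : Fintype.card F = 4) (hω : ω ^ 2 = ω + 1)
    (x c : Fin 10 → F) :
    ∑ j, ∑ k, phi ω (x j) k * phi ω (c j) k = 0 ↔
      (∑ j, x j * c j ^ 2) + (∑ j, x j * c j ^ 2) ^ 2 = 0 := by
  have := charP_two_of_card_eq_four hF
  rw [← map_eq_zero (ZMod.castHom (dvd_refl 2) F), map_sum]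
  simp only [cast_phi_inner hF hω, Finset.sum_add_distrib, CharTwo.sum_sq]

/-- For a linear code, the trace dual agrees with the Hermitian dual. -/
theorem mem_hermDual_iff_sum_phi [Fintype F] (hF : Fintype.card F = 4) (hω : ω ^ 2 = ω + 1)
    (C : Submodule F (Fin 10 → F)) (x : Fin 10 → F) :
    x ∈ hermDual (C : Set (Fin 10 → F)) ↔
      ∀ c ∈ C, ∑ j, ∑ k, phi ω (x j) k * phi ω (c j) k = 0 := by
  simp only [sum_phi_eq_zero_iff hF hω]
  refine ⟨fun h c hc => by simp [show ∑ j, x j * c j ^ 2 = 0 from h c hc], fun h c hc => ?_⟩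
  have := charP_two_of_card_eq_four hF
  have h2 : (2 : F) = 0 := CharTwo.two_eq_zero
  have h1 := h c hc
  have hs := h (ω • c) (C.smul_mem ω hc)
  have e : ∑ j, x j * (ω • c) j ^ 2 = ω ^ 2 * ∑ j, x j * c j ^ 2 := by
    rw [Finset.mul_sum]
    exact Finset.sum_congr rfl fun j _ => by simp only [Pi.smul_apply, smul_eq_mul]; ring
  rw [e] at hs
  grind

end Words

section SelfDual

theorem two_mul_finrank_of_selfDual {K ι : Type*} [Field K] [Fintype ι] [DecidableEq ι]
    {W : Submodule K (ι → K)} (hW : ∀ x, x ∈ W ↔ ∀ c ∈ W, x ⬝ᵥ c = 0) :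
    2 * Module.finrank K W = Fintype.card ι := by
  let B : LinearMap.BilinForm K (ι → K) := dotProductBilin K K
  have hr : B.IsRefl := fun x y h => (dotProduct_comm y x).trans h
  have hB : B.Nondegenerate :=
    hr.nondegenerate_iff_separatingLeft.2 fun x hx => dotProduct_eq_zero_iff.1 hx
  have ho : B.orthogonal W = W := by
    ext x
    rw [hW, LinearMap.BilinForm.mem_orthogonal_iff]
    refine forall₂_congr fun c _ => ?_
    rw [dotProduct_comm]
    rfl
  have h := LinearMap.BilinForm.finrank_orthogonal hB W
  rw [ho, Module.finrank_fintype_fun_eq_card] at h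
  have := W.finrank_le
  rw [Module.finrank_fintype_fun_eq_card] at this
  omega

theorem finrank_of_eq_binDual {W : Submodule (ZMod 2) (Fin 40 → ZMod 2)}
    (hW : (W : Set (Fin 40 → ZMod 2)) = binDual W) : Module.finrank (ZMod 2) W = 20 := by
  have h := two_mul_finrank_of_selfDual (W := W) fun x => Set.ext_iff.1 hW x
  rw [Fintype.card_fin] at h
  omega

variable {F : Type} [Field F] [DecidableEq F] {ω : F}

theorem even_hammingNorm_of_eq_binDual {S : Set (Fin 40 → ZMod 2)} (hS : S = binDual S)
    {v : Fin 40 → ZMod 2} (hv : v ∈ S) : Even (hammingNorm v) := by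
  have h : v ∈ binDual S := hS ▸ hv
  rw [even_hammingNorm_iff, ← h v hv]
  refine Finset.sum_congr rfl fun i _ => ?_
  generalize v i = x
  revert x
  decide

theorem eight_le_hammingNorm_of_mem_rhoC (C : Set (Fin 10 → F))
    (hC : ∀ c ∈ C, c ≠ 0 → 4 ≤ hammingNorm c) {v : Fin 40 → ZMod 2} (hv : v ∈ rhoC ω C)
    (hv0 : v ≠ 0) : 8 ≤ hammingNorm v := by
  obtain ⟨c, hc, u, t, hu, rfl⟩ := (mem_rhoC_iff ω _ _).1 hv
  have ht : t = 0 ∨ t = 1 := by clear hv hv0; revert t; decide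
  rcases ht with rfl | rfl
  · by_cases hc0 : c = 0
    · subst hc0
      have h0 : hammingNorm u ≠ 0 := by
        rw [hammingNorm_ne_zero_iff]
        rintro rfl
        exact hv0 (ext_idx fun j k => by simp)
      have := (even_hammingNorm_iff u).2 hu
      rw [hammingNorm_word_zero_zero]
      grind
    · calc 8 ≤ 2 * hammingNorm c := by have := hC c hc hc0; omega
        _ = ∑ j, 2 * if c j ≠ 0 then 1 else 0 := by rw [hammingNorm_eq_sum, Finset.mul_sum]
        _ ≤ _ := by
          rw [hammingNorm_eq_sum_columns]
          refine Finset.sum_le_sum fun j _ => ?_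
          split_ifs with h
          · simpa using two_le_hammingNorm_column ω h (u j)
          · simp
  · calc 8 ≤ ∑ _j : Fin 10, 1 := by simp
      _ ≤ _ := by
        rw [hammingNorm_eq_sum_columns]
        refine Finset.sum_le_sum fun j _ => ?_
        rw [Nat.one_le_iff_ne_zero, hammingNorm_ne_zero_iff]
        intro h
        have hs := congrArg (fun f : Fin 4 → ZMod 2 => ∑ k, f k) h
        have h4 : (4 : ZMod 2) = 0 := rfl
        simp [Finset.sum_add_distrib, sum_phi, h4] at hs

theorem hammingNorm_eCvec : hammingNorm eCvec = 10 := by decide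

theorem eCvec_mem_rhoC {C : Set (Fin 10 → F)} (hC : 0 ∈ C) : eCvec ∈ rhoC ω C :=
  (mem_rhoC_iff ω _ _).2 ⟨0, hC, 0, 1, by simp, ext_idx fun j k => by simp [eCvec_idx]⟩

theorem exists_mem_rhoC_hammingNorm_eq_eight {C : Set (Fin 10 → F)} (hC : 0 ∈ C) :
    ∃ v ∈ rhoC ω C, hammingNorm v = 8 := by
  refine ⟨word ω 0 ![1, 1, 0, 0, 0, 0, 0, 0, 0, 0] 0,
    (mem_rhoC_iff ω _ _).2 ⟨0, hC, _, 0, by decide, rfl⟩, ?_⟩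
  rw [hammingNorm_word_zero_zero]
  decide

variable [Fintype F]

/-- `ρ_C(C)` as a subspace, for a linear code `C`. -/
def rhoCSubmodule (hF : Fintype.card F = 4) (hω : ω ^ 2 = ω + 1)
    (C : Submodule F (Fin 10 → F)) : Submodule (ZMod 2) (Fin 40 → ZMod 2) :=
  AddSubgroup.toZModSubmodule 2
    { carrier := rhoC ω C
      zero_mem' := (mem_rhoC_iff ω _ _).2 ⟨0, C.zero_mem, 0, 0, by simp, ext_idx fun j k => by simp⟩
      add_mem' := by
        intro v w hv hw
        obtain ⟨c, hc, u, t, hu, rfl⟩ := (mem_rhoC_iff ω _ _).1 hv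
        obtain ⟨c', hc', u', t', hu', rfl⟩ := (mem_rhoC_iff ω _ _).1 hw
        exact (mem_rhoC_iff ω _ _).2 ⟨c + c', C.add_mem hc hc', u + u', t + t',
          by simp [Finset.sum_add_distrib, hu, hu'], word_add hF hω ..⟩
      neg_mem' := by
        intro v hv
        rwa [show -v = v from funext fun i => ZMod.neg_eq_self_mod_two (v i)] }

theorem coe_rhoCSubmodule (hF : Fintype.card F = 4) (hω : ω ^ 2 = ω + 1)
    (C : Submodule F (Fin 10 → F)) : (rhoCSubmodule hF hω C : Set _) = rhoC ω C := rfl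

theorem eq_word_of_colPar (hF : Fintype.card F = 4) (hω : ω ^ 2 = ω + 1)
    {v : Fin 40 → ZMod 2} {t : ZMod 2} (h : ∀ j, colPar v j = t) :
    v = word ω (Proj ω v) (fun j => v (idx j 0) + t) t := by
  refine ext_idx fun j k => ?_
  rw [word_idx, ← h j]
  exact column_eq hF hω (fun k => v (idx j k)) k

theorem rhoC_eq_binDual (hF : Fintype.card F = 4) (hω : ω ^ 2 = ω + 1)
    (C : Submodule F (Fin 10 → F)) (hC : hermDual (C : Set (Fin 10 → F)) = C) :
    rhoC ω (C : Set (Fin 10 → F)) = binDual (rhoC ω C) := by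
  have hdual (x : Fin 10 → F) :
      x ∈ C ↔ ∀ c ∈ C, ∑ j, ∑ k, phi ω (x j) k * phi ω (c j) k = 0 := by
    rw [← mem_hermDual_iff_sum_phi hF hω, hC, SetLike.mem_coe]
  refine Set.Subset.antisymm (fun v hv w hw => ?_) fun v hv => ?_
  · obtain ⟨c, hc, u, t, hu, rfl⟩ := (mem_rhoC_iff ω _ _).1 hv
    obtain ⟨c', hc', u', t', hu', rfl⟩ := (mem_rhoC_iff ω _ _).1 hw
    simp [sum_word_mul_word, hu, hu', (hdual c).1 hc c' hc']
  · have hv' (c) (hc : c ∈ C) (u : Fin 10 → ZMod 2) (t : ZMod 2) (hu : ∑ j, u j = 0) :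
        ∑ i, v i * word ω c u t i = 0 :=
      hv _ ((mem_rhoC_iff ω _ _).2 ⟨c, hc, u, t, hu, rfl⟩)
    have hpar (j : Fin 10) : colPar v j = colPar v 0 := by
      have h := hv' 0 C.zero_mem (Pi.single j 1 + Pi.single 0 1) 0
        (by simp [Finset.sum_add_distrib]; rfl)
      simp [sum_eq_sum_idx, mul_add, Finset.sum_add_distrib, Pi.single_apply] at h
      exact (CharTwo.add_eq_zero).1 h
    rw [eq_word_of_colPar hF hω hpar] at hv' ⊢
    simp only [sum_word_mul_word] at hv'
    refine (mem_rhoC_iff ω _ _).2 ⟨_, (hdual _).2 fun c hc => ?_, _, _, ?_, rfl⟩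
    · simpa using hv' c hc 0 0 (by simp)
    · simpa using hv' 0 C.zero_mem 0 1 (by simp)

theorem rhoC_selfDual (hF : Fintype.card F = 4) (hω : ω ^ 2 = ω + 1)
    (C : Submodule F (Fin 10 → F)) (hdual : hermDual (C : Set (Fin 10 → F)) = C)
    (hmin : ∀ c ∈ C, c ≠ 0 → 4 ≤ hammingNorm c) :
    (((Submodule.span (ZMod 2) (rhoC ω C) : Set (Fin 40 → ZMod 2)) = rhoC ω C ∧
        Module.finrank (ZMod 2) (Submodule.span (ZMod 2) (rhoC ω (C : Set (Fin 10 → F)))) = 20) ∧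
      rhoC ω C = binDual (rhoC ω C) ∧
      (∀ v ∈ rhoC ω C, Even (hammingNorm v)) ∧
      (∃ v ∈ rhoC ω C, hammingNorm v % 4 = 2) ∧
      (∀ v ∈ rhoC ω C, v ≠ 0 → 8 ≤ hammingNorm v) ∧
      (∃ v ∈ rhoC ω C, hammingNorm v = 8)) := by
  have hS := rhoC_eq_binDual hF hω C hdual
  have hspan : Submodule.span (ZMod 2) (rhoC ω C) = rhoCSubmodule hF hω C := by
    rw [← coe_rhoCSubmodule hF hω, Submodule.span_eq]
  refine ⟨⟨by rw [hspan, coe_rhoCSubmodule], ?_⟩, hS,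
    fun v hv => even_hammingNorm_of_eq_binDual hS hv,
    ⟨eCvec, eCvec_mem_rhoC C.zero_mem, by rw [hammingNorm_eCvec]⟩,
    fun v hv => eight_le_hammingNorm_of_mem_rhoC _ hmin hv,
    exists_mem_rhoC_hammingNorm_eq_eight C.zero_mem⟩
  rw [hspan]
  exact finrank_of_eq_binDual hS

end SelfDual

section HermitianCodes

variable {F : Type} [Field F] {ω : F}

theorem mem_span_quintuple {M : Type*} [AddCommGroup M] [Module F M] {v₁ v₂ v₃ v₄ v₅ x : M} :
    x ∈ Submodule.span F {v₁, v₂, v₃, v₄, v₅} ↔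
      ∃ a b c d e : F, x = a • v₁ + (b • v₂ + (c • v₃ + (d • v₄ + e • v₅))) := by
  simp only [Submodule.mem_span_insert, Submodule.mem_span_singleton]
  constructor
  · rintro ⟨a, _, ⟨b, _, ⟨c, _, ⟨d, _, ⟨e, rfl⟩, rfl⟩, rfl⟩, rfl⟩, rfl⟩
    exact ⟨a, b, c, d, e, rfl⟩
  · rintro ⟨a, b, c, d, e, rfl⟩
    exact ⟨a, _, ⟨b, _, ⟨c, _, ⟨d, _, ⟨e, rfl⟩, rfl⟩, rfl⟩, rfl⟩, rfl⟩

theorem mem_hermDual_span_iff [CharP F 2] {S : Set (Fin 10 → F)} {x : Fin 10 → F} :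
    x ∈ hermDual (Submodule.span F S : Set (Fin 10 → F)) ↔ ∀ s ∈ S, ∑ i, x i * s i ^ 2 = 0 := by
  refine ⟨fun h s hs => h s (Submodule.subset_span hs), fun h c hc => ?_⟩
  induction hc using Submodule.span_induction with
  | mem s hs => exact h s hs
  | zero => simp
  | add a b _ _ ha hb => simp [CharTwo.add_sq, mul_add, Finset.sum_add_distrib, ha, hb]
  | smul r a _ ha =>
    simp only [Pi.smul_apply, smul_eq_mul, mul_pow, mul_left_comm _ (r ^ 2), ← Finset.mul_sum, ha,
      mul_zero]

theorem mem_E10_iff {x : Fin 10 → F} :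
    x ∈ E10 ω ↔ ∃ a b c d e : F, x = ![a + e, a, a + b + e, a + b, b + c + e, b + c, c + d + e,
      c + d, d + e * ω, d + e * ω ^ 2] := by
  rw [E10, mem_span_quintuple]
  simp only [Matrix.smul_cons, Matrix.smul_empty, Matrix.add_cons, Matrix.empty_add_empty,
    Matrix.head_cons, Matrix.tail_cons, smul_eq_mul, mul_one, mul_zero, add_zero, zero_add,
    add_assoc]

theorem mem_B10_iff {x : Fin 10 → F} :
    x ∈ B10 ω ↔ ∃ a b c d e : F, x = ![a, a + (b + e), a + (b * ω + e * ω ^ 2),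
      a + (b * ω ^ 2 + e * ω), b, c, c + (d + e), c + (d * ω + e * ω ^ 2),
      c + (d * ω ^ 2 + e * ω), d] := by
  rw [B10, mem_span_quintuple]
  simp only [Matrix.smul_cons, Matrix.smul_empty, Matrix.add_cons, Matrix.empty_add_empty,
    Matrix.head_cons, Matrix.tail_cons, smul_eq_mul, mul_one, mul_zero, add_zero, zero_add]

theorem hermDual_E10 [CharP F 2] (hω : ω ^ 2 = ω + 1) :
    hermDual (E10 ω : Set (Fin 10 → F)) = E10 ω := by
  have h2 : (2 : F) = 0 := CharTwo.two_eq_zero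
  ext x
  rw [SetLike.mem_coe, mem_E10_iff, E10, mem_hermDual_span_iff]
  simp only [Set.mem_insert_iff, Set.mem_singleton_iff, forall_eq_or_imp, forall_eq,
    Fin.sum_univ_succ]
  simp
  constructor
  · rintro ⟨h₁, h₂, h₃, h₄, h₅⟩
    refine ⟨x 1, x 3 + x 1, x 5 + x 3 + x 1, x 7 + x 5 + x 3 + x 1, x 0 + x 1, ?_⟩
    funext i
    fin_cases i <;> simp <;> grind
  · rintro ⟨a, b, c, d, e, rfl⟩
    simp
    refine ⟨?_, ?_, ?_, ?_, ?_⟩ <;> grind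

theorem hermDual_B10 [CharP F 2] (hω : ω ^ 2 = ω + 1) :
    hermDual (B10 ω : Set (Fin 10 → F)) = B10 ω := by
  have h2 : (2 : F) = 0 := CharTwo.two_eq_zero
  ext x
  rw [SetLike.mem_coe, mem_B10_iff, B10, mem_hermDual_span_iff]
  simp only [Set.mem_insert_iff, Set.mem_singleton_iff, forall_eq_or_imp, forall_eq,
    Fin.sum_univ_succ]
  simp
  constructor
  · rintro ⟨h₁, h₂, h₃, h₄, h₅⟩
    refine ⟨x 0, x 4, x 5, x 9, x 6 + x 5 + x 9, ?_⟩
    funext i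
    fin_cases i <;> simp <;> grind
  · rintro ⟨a, b, c, d, e, rfl⟩
    simp
    refine ⟨?_, ?_, ?_, ?_, ?_⟩ <;> grind

variable [DecidableEq F]

/-- The Hamming weight of a single coordinate. -/
def wt (x : F) : ℕ := if x ≠ 0 then 1 else 0

theorem wt_eq_zero_iff {x : F} : wt x = 0 ↔ x = 0 := by simp [wt]

theorem wt_of_ne_zero {x : F} (h : x ≠ 0) : wt x = 1 := by simp [wt, h]

theorem wt_add_le (x y : F) : wt (x + y) ≤ wt x + wt y := by
  by_cases hx : x = 0
  · simp [hx]
  · rw [wt_of_ne_zero hx]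
    exact (ite_le_one le_rfl zero_le_one).trans (Nat.le_add_right 1 _)

theorem hammingNorm_vec_ten (a b c d e f g h i j : F) :
    hammingNorm ![a, b, c, d, e, f, g, h, i, j] = wt a + wt b + wt c + wt d + wt e + wt f + wt g +
      wt h + wt i + wt j := by
  rw [hammingNorm_eq_sum]
  change ∑ k, wt (![a, b, c, d, e, f, g, h, i, j] k) = _
  simp [Fin.sum_univ_succ, add_assoc]

theorem wt_le_of_sum_eq_zero [CharP F 2] {x y z u v : F} (h : x + y + z + u + v = 0) :
    wt x ≤ wt y + wt z + wt u + wt v := by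
  have hx : x = y + z + u + v := by
    rw [← CharTwo.add_eq_zero, ← h]
    ring
  have h₁ := wt_add_le (y + z + u) v
  have h₂ := wt_add_le (y + z) u
  have h₃ := wt_add_le y z
  rw [hx]
  omega

theorem one_le_wt_add_wt {x y e : F} (he : e ≠ 0) (h : x = y + e) : 1 ≤ wt x + wt y := by
  by_cases hy : y = 0
  · rw [h, hy, zero_add, wt_of_ne_zero he]
    omega
  · rw [wt_of_ne_zero hy]
    omega

theorem four_le_hammingNorm_E10 [CharP F 2] {x : Fin 10 → F} (hx : x ∈ E10 ω) (hx0 : x ≠ 0) :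
    4 ≤ hammingNorm x := by
  obtain ⟨a, b, c, d, e, rfl⟩ := mem_E10_iff.1 hx
  have h2 : (2 : F) = 0 := CharTwo.two_eq_zero
  rw [hammingNorm_vec_ten]
  by_cases he : e = 0
  · subst he
    simp only [add_zero, zero_mul] at hx0 ⊢
    by_contra! hlt
    have h₁ := wt_le_of_sum_eq_zero
      (show a + (a + b) + (b + c) + (c + d) + d = 0 by linear_combination (a + b + c + d) * h2)
    have h₂ := wt_le_of_sum_eq_zero
      (show (a + b) + a + (b + c) + (c + d) + d = 0 by linear_combination (a + b + c + d) * h2)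
    have h₃ := wt_le_of_sum_eq_zero
      (show (b + c) + a + (a + b) + (c + d) + d = 0 by linear_combination (a + b + c + d) * h2)
    have h₄ := wt_le_of_sum_eq_zero
      (show (c + d) + a + (a + b) + (b + c) + d = 0 by linear_combination (a + b + c + d) * h2)
    have h₅ := wt_le_of_sum_eq_zero
      (show d + a + (a + b) + (b + c) + (c + d) = 0 by linear_combination (a + b + c + d) * h2)
    have ha : a = 0 := wt_eq_zero_iff.1 (by omega)
    have hab : a + b = 0 := wt_eq_zero_iff.1 (by omega)
    have hbc : b + c = 0 := wt_eq_zero_iff.1 (by omega)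
    have hd : d = 0 := wt_eq_zero_iff.1 (by omega)
    have hb : b = 0 := by rwa [ha, zero_add] at hab
    have hc : c = 0 := by rwa [hb, zero_add] at hbc
    exact hx0 (by simp [ha, hb, hc, hd])
  · have h₁ := one_le_wt_add_wt (x := a + e) (y := a) he rfl
    have h₂ := one_le_wt_add_wt (x := a + b + e) (y := a + b) he rfl
    have h₃ := one_le_wt_add_wt (x := b + c + e) (y := b + c) he rfl
    have h₄ := one_le_wt_add_wt (x := c + d + e) (y := c + d) he rfl
    omega

/-- The weight of a word of the `[5,3,3]` code of which two copies are glued in `B₁₀`. -/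
def halfWt (ω a b e : F) : ℕ :=
  wt a + wt (a + (b + e)) + wt (a + (b * ω + e * ω ^ 2)) + wt (a + (b * ω ^ 2 + e * ω)) + wt b

/-- At most one of the values `a + b x + e x²`, for `x` in `GF(4)`, vanishes when exactly one of
`b`, `e` is zero. -/
theorem three_le_wt_of_mul_eq_zero [CharP F 2] (hω : ω ^ 2 = ω + 1) (a : F) {b e : F}
    (hbe : b * e = 0) (h : b ≠ 0 ∨ e ≠ 0) :
    3 ≤ wt a + wt (a + (b + e)) + wt (a + (b * ω + e * ω ^ 2)) +
      wt (a + (b * ω ^ 2 + e * ω)) := by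
  have h2 : (2 : F) = 0 := CharTwo.two_eq_zero
  have hω0 := omega_ne_zero hω
  have h₁ : b + e ≠ 0 := by grind
  have h₂ : b * ω + e * ω ^ 2 ≠ 0 := by grind
  have h₃ : b * ω ^ 2 + e * ω ≠ 0 := by grind
  have w₁ := one_le_wt_add_wt (x := a + (b + e)) (y := a) h₁ rfl
  have w₂ := one_le_wt_add_wt (x := a + (b * ω + e * ω ^ 2)) (y := a) h₂ rfl
  have w₃ := one_le_wt_add_wt (x := a + (b * ω ^ 2 + e * ω)) (y := a) h₃ rfl
  have w₄ := one_le_wt_add_wt (x := a + (b * ω + e * ω ^ 2)) (y := a + (b + e)) h₃ (by grind)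
  have w₅ := one_le_wt_add_wt (x := a + (b * ω ^ 2 + e * ω)) (y := a + (b + e)) h₂ (by grind)
  have w₆ := one_le_wt_add_wt (x := a + (b * ω ^ 2 + e * ω)) (y := a + (b * ω + e * ω ^ 2)) h₁
    (by grind)
  omega

theorem three_le_halfWt [CharP F 2] (hω : ω ^ 2 = ω + 1) (a b : F) {e : F} (he : e ≠ 0) :
    3 ≤ halfWt ω a b e := by
  have h2 : (2 : F) = 0 := CharTwo.two_eq_zero
  unfold halfWt
  by_cases hb : b = 0
  · have := three_le_wt_of_mul_eq_zero hω a (b := b) (e := e) (by simp [hb]) (.inr he)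
    omega
  · rw [wt_of_ne_zero hb]
    by_cases h₁ : b + e = 0
    · have h₂ : b * ω + e * ω ^ 2 ≠ 0 := by grind
      have w₁ := one_le_wt_add_wt (x := a + (b * ω + e * ω ^ 2)) (y := a) h₂ rfl
      have w₂ := one_le_wt_add_wt (x := a + (b * ω ^ 2 + e * ω)) (y := a + (b + e)) h₂ (by grind)
      omega
    · have w₁ := one_le_wt_add_wt (x := a + (b + e)) (y := a) h₁ rfl
      have w₂ := one_le_wt_add_wt (x := a + (b * ω ^ 2 + e * ω)) (y := a + (b * ω + e * ω ^ 2)) h₁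
        (by grind)
      omega

theorem four_le_halfWt [CharP F 2] (hω : ω ^ 2 = ω + 1) {a b : F} (h : a ≠ 0 ∨ b ≠ 0) :
    4 ≤ halfWt ω a b 0 := by
  unfold halfWt
  by_cases hb : b = 0
  · have ha : a ≠ 0 := by simpa [hb] using h
    simp [hb, wt_of_ne_zero ha]
  · have := three_le_wt_of_mul_eq_zero hω a (b := b) (e := 0) (by simp) (.inl hb)
    rw [wt_of_ne_zero hb]
    omega

theorem four_le_hammingNorm_B10 [CharP F 2] (hω : ω ^ 2 = ω + 1)
    {x : Fin 10 → F} (hx : x ∈ B10 ω) (hx0 : x ≠ 0) : 4 ≤ hammingNorm x := by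
  obtain ⟨a, b, c, d, e, rfl⟩ := mem_B10_iff.1 hx
  have hsum : 4 ≤ halfWt ω a b e + halfWt ω c d e := by
    by_cases he : e = 0
    · subst he
      by_cases hab : a ≠ 0 ∨ b ≠ 0
      · exact le_add_right (four_le_halfWt hω hab)
      · refine le_add_left (four_le_halfWt hω ?_)
        by_contra! hcd
        push Not at hab
        exact hx0 (by simp [hab, hcd])
    · have h₁ := three_le_halfWt hω a b he
      have h₂ := three_le_halfWt hω c d he
      omega
  rw [hammingNorm_vec_ten]
  simp only [halfWt] at hsum
  omega

end HermitianCodes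

/-- Each of ρ_C(E₁₀) and ρ_C(B₁₀) is a singly-even self-dual
binary [40,20,8] code. -/
theorem stmt_10 (F : Type) [Field F] [Fintype F] [DecidableEq F]
    (hF : Fintype.card F = 4) (ω : F) (hω : ω ^ 2 = ω + 1) :
    ∀ S ∈ ({rhoC ω (E10 ω : Set (Fin 10 → F)),
            rhoC ω (B10 ω : Set (Fin 10 → F))} : Set (Set (Fin 40 → ZMod 2))),
      ((Submodule.span (ZMod 2) S : Set (Fin 40 → ZMod 2)) = S ∧
        Module.finrank (ZMod 2) (Submodule.span (ZMod 2) S) = 20) ∧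
      S = binDual S ∧
      (∀ v ∈ S, Even (hammingNorm v)) ∧
      (∃ v ∈ S, hammingNorm v % 4 = 2) ∧
      (∀ v ∈ S, v ≠ 0 → 8 ≤ hammingNorm v) ∧
      (∃ v ∈ S, hammingNorm v = 8) := by
  have := charP_two_of_card_eq_four hF
  rintro S (rfl | rfl)
  · exact rhoC_selfDual hF hω _ (hermDual_E10 hω) fun _ => four_le_hammingNorm_E10
  · exact rhoC_selfDual hF hω _ (hermDual_B10 hω) fun _ => four_le_hammingNorm_B10 hω
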